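/- The function ε ↦ Δ(ε)/ε² is nondecreasing on (0, 1]; that is, for all 0 < ε ≤ ε₀ ≤ 1, Δ(ε)/ε² ≤ Δ(ε₀)/ε₀². Consequently, the limit of Δ(ε)/ε² as ε → 0⁺ exists. -/

import Mathlib

open MeasureTheory

/-- A set `C ⊆ ℝ` is symmetric if there is a center `c` with `c + x ∈ C ↔ c - x ∈ C`. -/
def IsSymmetricSet (C : Set ℝ) : Prop := ∃ c : ℝ, ∀ x : ℝ, c + x ∈ C ↔ c - x ∈ C

/-- `DD A` is the supremum of measures of measurable symmetric subsets of `A`. -/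
noncomputable def DD (A : Set ℝ) : ℝ :=
  sSup {m : ℝ | ∃ C : Set ℝ, C ⊆ A ∧ MeasurableSet C ∧ IsSymmetricSet C ∧ m = (volume C).toReal}

/-- `Δ ε` is the infimum of `DD A` over measurable `A ⊆ [0,1)` with measure `ε`. -/
noncomputable def Δ (ε : ℝ) : ℝ :=
  sInf {d : ℝ | ∃ A : Set ℝ, A ⊆ Set.Ico (0:ℝ) 1 ∧ MeasurableSet A ∧
    volume A = ENNReal.ofReal ε ∧ d = DD A}

/-- The `T`-periodic set meeting every period `[kT, (k+1)T)` in `[kT, (k+p)T)`. -/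
def stripes (T p : ℝ) : Set ℝ := {x | Int.fract (x / T) < p}

/-- The `i`-th cell of the partition of the line into half-open intervals of length `1 / n`. -/
def gridCell (n i : ℕ) : Set ℝ := Set.Ico ((i : ℝ) / n) (((i : ℝ) + 1) / n)

theorem measurableSet_stripes (T p : ℝ) : MeasurableSet (stripes T p) :=
  measurableSet_lt (measurable_fract.comp (measurable_id.div_const T)) measurable_const

theorem stripes_inter_period {T p : ℝ} (hT : 0 < T) (hp1 : p ≤ 1) (k : ℤ) :
    Set.Ico (k * T) (k * T + T) ∩ stripes T p = Set.Ico (k * T) (k * T + p * T) := by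
  ext x
  have key : x ∈ Set.Ico (k * T) (k * T + T) → Int.fract (x / T) = x / T - k := by
    rintro ⟨h1, h2⟩
    have : ⌊x / T⌋ = k := by
      rw [Int.floor_eq_iff]
      constructor
      · rwa [le_div_iff₀ hT]
      · rw [div_lt_iff₀ hT]; linarith
    rw [Int.fract, this]
  have key2 : x / T - k < p ↔ x < k * T + p * T := by
    rw [sub_lt_iff_lt_add, div_lt_iff₀ hT]
    ring_nf
  constructor
  · rintro ⟨h1, h2⟩
    have h3 : Int.fract (x / T) < p := h2
    rw [key h1, key2] at h3
    exact ⟨h1.1, h3⟩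
  · rintro ⟨h1, h2⟩
    have h4 : x ∈ Set.Ico (k * T) (k * T + T) := ⟨h1, by nlinarith⟩
    refine ⟨h4, ?_⟩
    change Int.fract (x / T) < p
    rw [key h4, key2]
    exact h2

theorem measureReal_Ico_inter_stripes {T p : ℝ} (hT : 0 < T) (hp0 : 0 ≤ p) (hp1 : p ≤ 1)
    (a : ℝ) (k : ℕ) :
    volume.real (Set.Ico a (a + k * T) ∩ stripes T p) = k * (p * T) := by
  have hS := measurableSet_stripes T p
  let f : ℝ → ℝ := (stripes T p).indicator 1
  have hper : Function.Periodic f T := by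
    intro x
    have : x + T ∈ stripes T p ↔ x ∈ stripes T p := by
      simp [stripes, add_div, div_self hT.ne']
    by_cases hx : x ∈ stripes T p
    · simp [f, hx, this.2 hx]
    · simp [f, hx, mt this.1 hx]
  have hf : ∀ u v : ℝ, u ≤ v → ∫ x in u..v, f x = volume.real (Set.Ico u v ∩ stripes T p) := by
    intro u v huv
    rw [intervalIntegral.integral_of_le huv, ← integral_Ico_eq_integral_Ioc,
      integral_indicator_one hS, measureReal_restrict_apply hS, Set.inter_comm]
  have hint : ∀ u v : ℝ, IntervalIntegrable f volume u v := by
    intro u v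
    rw [intervalIntegrable_iff]
    exact (integrableOn_const (C := (1 : ℝ)) (by simp)).indicator hS
  have h0 : ∫ x in (0:ℝ)..T, f x = p * T := by
    rw [hf 0 T hT.le]
    have := stripes_inter_period hT hp1 0
    simp only [Int.cast_zero, zero_mul, zero_add] at this
    rw [this, Real.volume_real_Ico_of_le (by positivity), sub_zero]
  have h1 := hper.intervalIntegral_add_zsmul_eq (k : ℤ) a hint
  rw [hper.intervalIntegral_add_eq a 0, zero_add, h0] at h1
  simp only [zsmul_eq_mul, Int.cast_natCast] at h1
  rw [← h1, hf]
  have : 0 ≤ (k : ℝ) * T := by positivity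
  linarith

theorem Set.OrdConnected.measureReal_inter_stripes_le {T p : ℝ} (hT : 0 < T) (hp0 : 0 ≤ p)
    (hp1 : p ≤ 1) {J : Set ℝ} (hJ : J.OrdConnected) (hb : Bornology.IsBounded J) :
    volume.real (J ∩ stripes T p) ≤ p * volume.real J + T := by
  rcases J.eq_empty_or_nonempty with rfl | hne
  · simpa using hT.le
  have hI := IsConnected.Ioo_csInf_csSup_subset ⟨hne, hJ.isPreconnected⟩ hb.bddBelow hb.bddAbove
  have hsub := subset_Icc_csInf_csSup hb.bddBelow hb.bddAbove
  set a := sInf J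
  set b := sSup J
  obtain ⟨x, hx⟩ := hne
  have hab : a ≤ b := (hsub hx).1.trans (hsub hx).2
  have hlen : b - a ≤ volume.real J := by
    rw [← Real.volume_real_Ioo_of_le hab]
    exact measureReal_mono hI hb.measure_lt_top.ne
  set k := ⌊(b - a) / T⌋₊
  have hk1 : (k : ℝ) * T ≤ b - a := by
    rw [← le_div_iff₀ hT]
    exact Nat.floor_le (div_nonneg (by linarith) hT.le)
  have hk2 : b < a + ((k + 1 : ℕ) : ℝ) * T := by
    have := Nat.lt_floor_add_one ((b - a) / T)
    rw [div_lt_iff₀ hT] at this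
    push_cast
    linarith
  have h1 : volume.real (J ∩ stripes T p) ≤ ((k + 1 : ℕ) : ℝ) * (p * T) := by
    rw [← measureReal_Ico_inter_stripes hT hp0 hp1 a (k + 1)]
    refine measureReal_mono (Set.inter_subset_inter_left _ fun y hy => ?_)
      (measure_ne_top_of_subset Set.inter_subset_left (by simp))
    exact ⟨(hsub hy).1, (hsub hy).2.trans_lt hk2⟩
  push_cast at h1
  nlinarith

theorem measureReal_preimage_sub_left (c : ℝ) {s : Set ℝ} (hs : MeasurableSet s) :
    volume.real ((fun x => c - x) ⁻¹' s) = volume.real s :=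
  (volume.measurePreserving_sub_left c).measureReal_preimage hs.nullMeasurableSet

theorem preimage_sub_left_preimage_sub_left (c : ℝ) (s : Set ℝ) :
    (fun x => c - x) ⁻¹' ((fun x => c - x) ⁻¹' s) = s := by
  ext x
  simp

theorem antitone_sub_left (c : ℝ) : Antitone fun x : ℝ => c - x :=
  fun _ _ h => sub_le_sub_left h c

theorem Set.OrdConnected.measureReal_inter_preimage_stripes_le {T p : ℝ} (hT : 0 < T)
    (hp0 : 0 ≤ p) (hp1 : p ≤ 1) {J : Set ℝ} (hJ : J.OrdConnected) (hb : Bornology.IsBounded J)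
    (c : ℝ) :
    volume.real (J ∩ (fun x => c - x) ⁻¹' stripes T p) ≤ p * volume.real J + T := by
  have hb' : Bornology.IsBounded ((fun x => c - x) ⁻¹' J) := by
    obtain ⟨R, hR⟩ := hb.exists_norm_le
    refine isBounded_iff_forall_norm_le.2 ⟨‖c‖ + R, fun x hx => ?_⟩
    calc ‖x‖ = ‖c - (c - x)‖ := by simp
      _ ≤ ‖c‖ + ‖c - x‖ := norm_sub_le _ _
      _ ≤ ‖c‖ + R := by gcongr; exact hR _ hx
  have h := (hJ.preimage_anti (antitone_sub_left c)).measureReal_inter_stripes_le hT hp0 hp1 hb'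
  rw [measureReal_preimage_sub_left c hJ.measurableSet] at h
  rw [← measureReal_preimage_sub_left c
    (hJ.measurableSet.inter ((measurableSet_stripes T p).preimage (by fun_prop))),
    Set.preimage_inter, preimage_sub_left_preimage_sub_left]
  exact h

theorem Set.OrdConnected.measureReal_inter_stripes_inter_preimage_stripes_le {N : ℕ} {U p : ℝ}
    (hN : 0 < N) (hU : 0 < U) (hp0 : 0 ≤ p) (hp1 : p ≤ 1) {J : Set ℝ} (hJ : J.OrdConnected)
    (hJ1 : J ⊆ Set.Ico 0 1) (c : ℝ) :
    volume.real (J ∩ stripes (1 / N) p ∩ (fun x => c - x) ⁻¹' stripes U p) ≤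
      p ^ 2 * volume.real J + 1 / N + N * U := by
  have hN' : (0 : ℝ) < N := by exact_mod_cast hN
  have hb : Bornology.IsBounded J := (Metric.isBounded_Ico 0 1).subset hJ1
  have hT : (0 : ℝ) < 1 / N := by positivity
  let I : ℕ → Set ℝ := fun k => Set.Ico ((k : ℤ) * (1 / N : ℝ)) ((k : ℤ) * (1 / N : ℝ) + p * (1 / N))
  have hI : ∀ k : ℕ, Set.Ico ((k : ℤ) * (1 / N : ℝ)) ((k : ℤ) * (1 / N : ℝ) + 1 / N) ∩
      stripes (1 / N) p = I k := fun k => stripes_inter_period hT hp1 k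
  have hcover : J ∩ stripes (1 / N) p ⊆ ⋃ k ∈ Finset.range N, J ∩ I k := by
    rintro x ⟨hx, hxs⟩
    have hx0 := (hJ1 hx).1
    have hx1 := (hJ1 hx).2
    have hfl := Nat.floor_le (show 0 ≤ x * N by positivity)
    have hlt := Nat.lt_floor_add_one (x * N)
    simp only [Set.mem_iUnion, Finset.mem_range]
    refine ⟨⌊x * N⌋₊, ?_, hx, ?_⟩
    · rw [Nat.floor_lt (by positivity)]
      nlinarith
    · rw [← hI]
      refine ⟨⟨?_, ?_⟩, hxs⟩
      · rw [mul_one_div, div_le_iff₀ hN']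
        exact_mod_cast hfl
      · rw [mul_one_div, ← add_div, lt_div_iff₀ hN']
        exact_mod_cast hlt
  have hdisj : Set.PairwiseDisjoint (↑(Finset.range N)) fun k => J ∩ I k := by
    have hlt : ∀ k l : ℕ, k < l → Disjoint (J ∩ I k) (J ∩ I l) := by
      intro k l hkl
      rw [Set.disjoint_left]
      rintro x ⟨-, -, h1⟩ ⟨-, h2, -⟩
      have h3 : ((k : ℝ) + 1) ≤ l := by exact_mod_cast hkl
      push_cast at h1 h2
      nlinarith
    intro k _ l _ hkl
    rcases lt_or_gt_of_ne hkl with h | h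
    · exact hlt k l h
    · exact (hlt l k h).symm
  have hfin : ∀ s ⊆ J, volume s ≠ ⊤ := fun s hs =>
    measure_ne_top_of_subset hs hb.measure_lt_top.ne
  have hIm : ∀ k, MeasurableSet (J ∩ I k) := fun k => hJ.measurableSet.inter measurableSet_Ico
  calc volume.real (J ∩ stripes (1 / N) p ∩ (fun x => c - x) ⁻¹' stripes U p)
      ≤ volume.real (⋃ k ∈ Finset.range N, J ∩ I k ∩ (fun x => c - x) ⁻¹' stripes U p) := by
        refine measureReal_mono (fun x hx => ?_)
          (hfin _ (Set.iUnion₂_subset fun k _ x hx => hx.1.1))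
        have := hcover hx.1
        simp only [Set.mem_iUnion] at this ⊢
        obtain ⟨k, hk, h⟩ := this
        exact ⟨k, hk, h, hx.2⟩
    _ ≤ ∑ k ∈ Finset.range N,
          volume.real (J ∩ I k ∩ (fun x => c - x) ⁻¹' stripes U p) :=
        measureReal_biUnion_finset_le _ _
    _ ≤ ∑ k ∈ Finset.range N, (p * volume.real (J ∩ I k) + U) := by
        gcongr with k _
        exact (hJ.inter Set.ordConnected_Ico).measureReal_inter_preimage_stripes_le hU hp0 hp1
          (hb.subset Set.inter_subset_left) c
    _ = p * volume.real (⋃ k ∈ Finset.range N, J ∩ I k) + N * U := by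
        rw [measureReal_biUnion_finset hdisj (fun k _ => hIm k)
          (fun k _ => hfin _ Set.inter_subset_left), Finset.sum_add_distrib, Finset.mul_sum]
        simp
    _ ≤ p * volume.real (J ∩ stripes (1 / N) p) + N * U := by
        gcongr
        · exact hfin _ Set.inter_subset_left
        · refine Set.iUnion₂_subset fun k _ x hx => ⟨hx.1, ?_⟩
          have := hx.2
          rw [← hI] at this
          exact this.2
    _ ≤ p * (p * volume.real J + 1 / N) + N * U := by
        gcongr
        exact hJ.measureReal_inter_stripes_le hT hp0 hp1 hb
    _ ≤ p ^ 2 * volume.real J + 1 / N + N * U := by nlinarith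

theorem gridCell_subset_Ico {n i : ℕ} (hi : i < n) : gridCell n i ⊆ Set.Ico 0 1 := by
  have hn : (0 : ℝ) < n := by exact_mod_cast (Nat.zero_le i).trans_lt hi
  have hi' : (i : ℝ) + 1 ≤ n := by exact_mod_cast hi
  exact Set.Ico_subset_Ico (by positivity) ((div_le_one hn).2 hi')

theorem abs_sub_lt_of_mem_gridCell {n i : ℕ} {x y : ℝ} (hx : x ∈ gridCell n i)
    (hy : y ∈ gridCell n i) : |x - y| < 1 / n := by
  obtain ⟨h1, h2⟩ := hx
  obtain ⟨h3, h4⟩ := hy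
  rw [add_div] at h2 h4
  rw [abs_lt]
  constructor <;> linarith

theorem pairwise_disjoint_gridCell (n : ℕ) : Pairwise (Function.onFun Disjoint (gridCell n)) := by
  have hlt : ∀ k l : ℕ, k < l → Disjoint (gridCell n k) (gridCell n l) := by
    intro k l hkl
    rw [Set.disjoint_left]
    rintro x ⟨-, h1⟩ ⟨h2, -⟩
    have h3 : ((k : ℝ) + 1) ≤ l := by exact_mod_cast hkl
    have h4 : ((k : ℝ) + 1) / n ≤ l / n := by gcongr
    linarith
  intro k l hkl
  rcases lt_or_gt_of_ne hkl with h | h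
  · exact hlt k l h
  · exact (hlt l k h).symm

theorem measureReal_gridCell_inter_stripes {n m i : ℕ} (hn : 0 < n) (hm : 0 < m) {p : ℝ}
    (hp0 : 0 ≤ p) (hp1 : p ≤ 1) :
    volume.real (gridCell n i ∩ stripes (1 / (n * m : ℕ)) p) =
      p * volume.real (gridCell n i) := by
  have hn' : (0 : ℝ) < n := by exact_mod_cast hn
  have hm' : (0 : ℝ) < m := by exact_mod_cast hm
  have hT : (0 : ℝ) < 1 / (n * m : ℕ) := by push_cast; positivity
  have h := measureReal_Ico_inter_stripes hT hp0 hp1 (i / n) m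
  have he : (i : ℝ) / n + m * (1 / (n * m : ℕ)) = ((i : ℝ) + 1) / n := by
    push_cast
    field_simp
  rw [he] at h
  rw [gridCell, h, Real.volume_real_Ico_of_le (by gcongr; linarith)]
  push_cast
  field_simp
  ring

/-- A union of grid cells contains a subset of relative density `p` whose overlaps with its
reflections are at most about `p ^ 2` times those of the whole union. -/
theorem exists_subset_biUnion_gridCell {n : ℕ} (hn : 0 < n) {S : Finset ℕ}
    (hS : ∀ i ∈ S, i < n) {p δ : ℝ} (hp0 : 0 ≤ p) (hp1 : p ≤ 1) (hδ : 0 < δ) :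
    ∃ B ⊆ ⋃ i ∈ S, gridCell n i, MeasurableSet B ∧
      volume.real B = p * volume.real (⋃ i ∈ S, gridCell n i) ∧
      ∀ c, volume.real (B ∩ (fun x => c - x) ⁻¹' B) ≤
        p ^ 2 * volume.real ((⋃ i ∈ S, gridCell n i) ∩
          (fun x => c - x) ⁻¹' ⋃ i ∈ S, gridCell n i) + 1 / n + δ := by
  have hn' : (0 : ℝ) < n := by exact_mod_cast hn
  obtain ⟨q, hq⟩ := exists_nat_gt (max 1 (2 * (S.card : ℝ) ^ 2 / δ))
  have hq1 : (1 : ℝ) < q := (le_max_left _ _).trans_lt hq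
  have hq0 : 0 < q := by
    have : (0 : ℝ) < q := by linarith
    exact_mod_cast this
  have hq0' : (0 : ℝ) < q := by exact_mod_cast hq0
  have hqδ : (S.card : ℝ) ^ 2 * (2 / q) ≤ δ := by
    have := (le_max_right _ _).trans_lt hq
    rw [div_lt_iff₀ hδ] at this
    rw [mul_div_assoc', div_le_iff₀ hq0']
    linarith
  set A := ⋃ i ∈ S, gridCell n i
  let N : ℕ → ℕ := fun i => n * q ^ (i + 1)
  have hNpos : ∀ i, 0 < N i := fun i => by positivity
  let P : ℕ → Set ℝ := fun i => stripes (1 / N i) p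
  let C : ℕ → Set ℝ := fun i => gridCell n i ∩ P i
  let B : Set ℝ := ⋃ i ∈ S, C i
  let R : ℝ → ℝ → ℝ := fun c x => c - x
  have hPm : ∀ i, MeasurableSet (P i) := fun i => measurableSet_stripes _ _
  have hGm : ∀ i, MeasurableSet (gridCell n i) := fun i => measurableSet_Ico
  have hCm : ∀ i, MeasurableSet (C i) := fun i => (hGm i).inter (hPm i)
  have hRm : ∀ c, Measurable (R c) := fun c => by fun_prop
  have hBA : B ⊆ A := Set.iUnion₂_mono fun i _ => Set.inter_subset_left
  have hA1 : A ⊆ Set.Ico 0 1 := Set.iUnion₂_subset fun i hi => gridCell_subset_Ico (hS i hi)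
  have hfin : ∀ s ⊆ Set.Ico (0 : ℝ) 1, volume s ≠ ⊤ := fun s hs =>
    measure_ne_top_of_subset hs (by simp)
  have hGfin : ∀ i ∈ S, volume (gridCell n i) ≠ ⊤ := fun i hi =>
    hfin _ (gridCell_subset_Ico (hS i hi))
  have hdisj := pairwise_disjoint_gridCell n
  refine ⟨B, hBA, S.measurableSet_biUnion fun i _ => hCm i, ?_, fun c => ?_⟩
  · rw [measureReal_biUnion_finset (fun i _ j _ hij => (hdisj hij).mono Set.inter_subset_left
        Set.inter_subset_left) (fun i _ => hCm i)
        (fun i hi => measure_ne_top_of_subset Set.inter_subset_left (hGfin i hi)),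
      measureReal_biUnion_finset (fun i _ j _ hij => hdisj hij) (fun i _ => hGm i) hGfin,
      Finset.mul_sum]
    exact Finset.sum_congr rfl fun i _ =>
      measureReal_gridCell_inter_stripes hn (by positivity) hp0 hp1
  have hlt : ∀ i ∈ S, ∀ j, i < j → ∀ c, volume.real (C i ∩ R c ⁻¹' C j) ≤
      p ^ 2 * volume.real (gridCell n i ∩ R c ⁻¹' gridCell n j) + 2 / q := by
    intro i hi j hij c
    have hJ : (gridCell n i ∩ R c ⁻¹' gridCell n j).OrdConnected :=
      Set.ordConnected_Ico.inter (Set.ordConnected_Ico.preimage_anti (antitone_sub_left c))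
    have hU : (0 : ℝ) < 1 / N j := by have := hNpos j; positivity
    have h := hJ.measureReal_inter_stripes_inter_preimage_stripes_le (hNpos i) hU hp0 hp1
      (Set.inter_subset_left.trans (gridCell_subset_Ico (hS i hi))) c
    have hset : C i ∩ R c ⁻¹' C j = gridCell n i ∩ R c ⁻¹' gridCell n j ∩ P i ∩ R c ⁻¹' P j := by
      simp only [C, Set.preimage_inter]
      ac_rfl
    have h1 : (1 : ℝ) / N i ≤ 1 / q := by
      apply one_div_le_one_div_of_le hq0'
      have : q ≤ n * q ^ (i + 1) :=
        (Nat.le_self_pow (by omega) q).trans (Nat.le_mul_of_pos_left _ hn)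
      exact_mod_cast this
    have h2 : (N i : ℝ) * (1 / N j) ≤ 1 / q := by
      have hj : (0 : ℝ) < N j := by exact_mod_cast hNpos j
      rw [mul_one_div, div_le_div_iff₀ hj hq0', one_mul]
      have : n * q ^ (i + 1) * q ≤ n * q ^ (j + 1) := by
        rw [mul_assoc, ← pow_succ]
        exact Nat.mul_le_mul_left _ (Nat.pow_le_pow_right hq0 (by omega))
      exact_mod_cast this
    have h3 : (2 : ℝ) / q = 1 / q + 1 / q := by ring
    rw [hset]
    simp only [P, R] at h ⊢
    linarith
  have hne : ∀ i ∈ S, ∀ j ∈ S, i ≠ j → volume.real (C i ∩ R c ⁻¹' C j) ≤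
      p ^ 2 * volume.real (gridCell n i ∩ R c ⁻¹' gridCell n j) + 2 / q := by
    intro i hi j hj hij
    rcases lt_or_gt_of_ne hij with h | h
    · exact hlt i hi j h c
    · have hswap : ∀ s t : Set ℝ, MeasurableSet s → MeasurableSet t →
          volume.real (s ∩ R c ⁻¹' t) = volume.real (t ∩ R c ⁻¹' s) := by
        intro s t hs ht
        rw [← measureReal_preimage_sub_left c (hs.inter (ht.preimage (hRm c))),
          Set.preimage_inter, preimage_sub_left_preimage_sub_left, Set.inter_comm]
      rw [hswap _ _ (hCm i) (hCm j), hswap _ _ (hGm i) (hGm j)]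
      exact hlt j hj i h c
  let D : Set ℝ := Set.Ioo ((c - 1 / n) / 2) ((c + 1 / n) / 2)
  have hcover : B ∩ R c ⁻¹' B ⊆ D ∪ ⋃ ij ∈ S.offDiag, C ij.1 ∩ R c ⁻¹' C ij.2 := by
    rintro x ⟨hx, hcx⟩
    simp only [B, Set.mem_preimage, Set.mem_iUnion] at hx hcx
    obtain ⟨i, hi, hxi⟩ := hx
    obtain ⟨j, hj, hxj⟩ := hcx
    by_cases hij : i = j
    · subst hij
      left
      have := abs_lt.1 (abs_sub_lt_of_mem_gridCell hxi.1 hxj.1)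
      simp only [R] at this
      constructor <;> linarith
    · right
      simp only [Set.mem_iUnion]
      exact ⟨(i, j), Finset.mem_offDiag.2 ⟨hi, hj, hij⟩, hxi, hxj⟩
  have hD : volume.real D = 1 / n := by
    have : (0 : ℝ) < 1 / n := by positivity
    rw [Real.volume_real_Ioo_of_le (by linarith)]
    ring
  have hCC : (⋃ ij ∈ S.offDiag, C ij.1 ∩ R c ⁻¹' C ij.2) ⊆ Set.Ico 0 1 :=
    Set.iUnion₂_subset fun ij hij => Set.inter_subset_left.trans
      (Set.inter_subset_left.trans (gridCell_subset_Ico (hS _ (Finset.mem_offDiag.1 hij).1)))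
  have hcard : (S.offDiag.card : ℝ) ≤ (S.card : ℝ) ^ 2 := by
    have : S.offDiag.card ≤ S.card ^ 2 := by
      rw [Finset.offDiag_card, sq]
      exact Nat.sub_le _ _
    exact_mod_cast this
  calc volume.real (B ∩ R c ⁻¹' B)
      ≤ volume.real (D ∪ ⋃ ij ∈ S.offDiag, C ij.1 ∩ R c ⁻¹' C ij.2) :=
        measureReal_mono hcover (measure_union_ne_top (by simp [D]) (hfin _ hCC))
    _ ≤ volume.real D + volume.real (⋃ ij ∈ S.offDiag, C ij.1 ∩ R c ⁻¹' C ij.2) :=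
        measureReal_union_le _ _
    _ ≤ 1 / n + ∑ ij ∈ S.offDiag, volume.real (C ij.1 ∩ R c ⁻¹' C ij.2) := by
        rw [hD]
        gcongr
        exact measureReal_biUnion_finset_le _ _
    _ ≤ 1 / n + ∑ ij ∈ S.offDiag,
          (p ^ 2 * volume.real (gridCell n ij.1 ∩ R c ⁻¹' gridCell n ij.2) + 2 / q) := by
        gcongr with ij hij
        obtain ⟨h1, h2, h3⟩ := Finset.mem_offDiag.1 hij
        exact hne _ h1 _ h2 h3
    _ = 1 / n + (p ^ 2 * volume.real
          (⋃ ij ∈ S.offDiag, gridCell n ij.1 ∩ R c ⁻¹' gridCell n ij.2) +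
          S.offDiag.card * (2 / q)) := by
        rw [measureReal_biUnion_finset (h := fun ij hij => measure_ne_top_of_subset
          Set.inter_subset_left (hGfin _ (Finset.mem_offDiag.1 hij).1)), Finset.sum_add_distrib, Finset.mul_sum]
        · simp
        · rintro ⟨i, j⟩ _ ⟨k, l⟩ _ hne
          by_cases hik : i = k
          · have hjl : j ≠ l := fun h => hne (by rw [hik, h])
            exact ((hdisj hjl).preimage (R c)).mono Set.inter_subset_right Set.inter_subset_right
          · exact (hdisj hik).mono Set.inter_subset_left Set.inter_subset_left
        · exact fun ij _ => (hGm _).inter ((hGm _).preimage (hRm c))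
    _ ≤ 1 / n + (p ^ 2 * volume.real (A ∩ R c ⁻¹' A) + (S.card : ℝ) ^ 2 * (2 / q)) := by
        gcongr
        · exact hfin _ (Set.inter_subset_left.trans hA1)
        · refine Set.iUnion₂_subset fun ij hij => ?_
          obtain ⟨h1, h2, -⟩ := Finset.mem_offDiag.1 hij
          exact Set.inter_subset_inter (Set.subset_biUnion_of_mem (u := gridCell n) h1)
            (Set.preimage_mono (Set.subset_biUnion_of_mem (u := gridCell n) h2))
    _ ≤ _ := by linarith

/-- A measurable subset of `[0, 1)` is approximated in measure by a union of cells of a fine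
grid. -/
theorem exists_biUnion_gridCell_approx {A : Set ℝ} (hA : MeasurableSet A)
    (hA1 : A ⊆ Set.Ico 0 1) {δ : ℝ} (hδ : 0 < δ) :
    ∃ n : ℕ, 0 < n ∧ (1 : ℝ) / n < δ ∧ ∃ S : Finset ℕ, (∀ i ∈ S, i < n) ∧
      volume.real A - δ ≤ volume.real (⋃ i ∈ S, gridCell n i) ∧
      volume.real ((⋃ i ∈ S, gridCell n i) \ A) ≤ δ := by
  classical
  have hAfin : volume A ≠ ⊤ := measure_ne_top_of_subset hA1 (by simp)
  obtain ⟨K, hKA, hK, hKlt⟩ := hA.exists_isCompact_lt_add hAfin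
    (ENNReal.ofReal_pos.2 hδ).ne'
  have hKfin : volume K ≠ ⊤ := hK.measure_lt_top.ne
  have hth := tendsto_measure_cthickening_of_isCompact (μ := volume) hK
  have hev := hth.eventually (gt_mem_nhds
    (ENNReal.lt_add_right hKfin (ENNReal.ofReal_pos.2 hδ).ne'))
  obtain ⟨r, hr0, hr⟩ := Metric.eventually_nhds_iff.1 hev
  obtain ⟨n, hn⟩ := exists_nat_one_div_lt (lt_min (half_pos hr0) hδ)
  have hcth : volume (Metric.cthickening (r / 2) K) < volume K + ENNReal.ofReal δ := by
    apply hr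
    rw [Real.dist_eq, sub_zero, abs_of_pos (half_pos hr0)]
    linarith
  have hcfin : volume (Metric.cthickening (r / 2) K) ≠ ⊤ :=
    hK.isBounded.cthickening.measure_lt_top.ne
  have hn1 : (1 : ℝ) / (n + 1 : ℕ) < min (r / 2) δ := by exact_mod_cast hn
  let S : Finset ℕ := {i ∈ Finset.range (n + 1) | (gridCell (n + 1) i ∩ K).Nonempty}
  have hSn : ∀ i ∈ S, i < n + 1 := fun i hi => Finset.mem_range.1 (Finset.mem_filter.1 hi).1
  have hn0 : (0 : ℝ) < (n + 1 : ℕ) := by positivity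
  refine ⟨n + 1, n.succ_pos, hn1.trans_le (min_le_right _ _), S, hSn, ?_, ?_⟩
  · have hKS : K ⊆ ⋃ i ∈ S, gridCell (n + 1) i := by
      intro x hx
      have hx0 := (hA1 (hKA hx)).1
      have hx1 := (hA1 (hKA hx)).2
      have hfl := Nat.floor_le (show 0 ≤ x * (n + 1 : ℕ) by positivity)
      have hlt := Nat.lt_floor_add_one (x * (n + 1 : ℕ))
      have hmem : x ∈ gridCell (n + 1) ⌊x * (n + 1 : ℕ)⌋₊ :=
        ⟨by rwa [div_le_iff₀ hn0], by rwa [lt_div_iff₀ hn0]⟩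
      simp only [Set.mem_iUnion]
      refine ⟨_, Finset.mem_filter.2 ⟨Finset.mem_range.2 ?_, ⟨x, hmem, hx⟩⟩, hmem⟩
      rw [Nat.floor_lt (by positivity)]
      nlinarith
    have h1 : volume.real A ≤ volume.real K + δ := by
      have := ENNReal.toReal_mono (by finiteness) hKlt.le
      rwa [ENNReal.toReal_add hKfin (by finiteness), ENNReal.toReal_ofReal hδ.le] at this
    have h2 : volume.real K ≤ volume.real (⋃ i ∈ S, gridCell (n + 1) i) :=
      measureReal_mono hKS (measure_ne_top_of_subset
        (Set.iUnion₂_subset fun i hi => gridCell_subset_Ico (hSn i hi)) (by simp))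
    linarith
  · have hsub : (⋃ i ∈ S, gridCell (n + 1) i) \ A ⊆ Metric.cthickening (r / 2) K \ K := by
      rintro x ⟨hx, hxA⟩
      refine ⟨?_, fun h => hxA (hKA h)⟩
      simp only [Set.mem_iUnion] at hx
      obtain ⟨i, hi, hxi⟩ := hx
      obtain ⟨y, hyi, hyK⟩ := (Finset.mem_filter.1 hi).2
      refine Metric.mem_cthickening_of_dist_le x y _ _ hyK ?_
      rw [Real.dist_eq]
      exact ((abs_sub_lt_of_mem_gridCell hxi hyi).trans
        (hn1.trans_le (min_le_left _ _))).le
    calc volume.real ((⋃ i ∈ S, gridCell (n + 1) i) \ A)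
        ≤ volume.real (Metric.cthickening (r / 2) K \ K) :=
          measureReal_mono hsub (measure_ne_top_of_subset Set.sdiff_subset hcfin)
      _ = volume.real (Metric.cthickening (r / 2) K) - volume.real K :=
          measureReal_sdiff (Metric.self_subset_cthickening K) hK.measurableSet hcfin
      _ ≤ δ := by
          have := ENNReal.toReal_mono (by finiteness) hcth.le
          rw [ENNReal.toReal_add hKfin (by finiteness), ENNReal.toReal_ofReal hδ.le] at this
          simp only [Measure.real]
          linarith

theorem measureReal_inter_preimage_le_DD {A : Set ℝ} (hA : MeasurableSet A)
    (hfin : volume A ≠ ⊤) (c : ℝ) :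
    volume.real (A ∩ (fun x => c - x) ⁻¹' A) ≤ DD A := by
  refine le_csSup ⟨volume.real A, ?_⟩ ⟨_, Set.inter_subset_left,
    hA.inter (hA.preimage (by fun_prop)), ⟨c / 2, fun x => ?_⟩, rfl⟩
  · rintro _ ⟨C, hC, -, -, rfl⟩
    exact measureReal_mono hC hfin
  · have h1 : c - (c / 2 + x) = c / 2 - x := by ring
    have h2 : c - (c / 2 - x) = c / 2 + x := by ring
    simp only [Set.mem_inter_iff, Set.mem_preimage, h1, h2]
    exact and_comm

theorem DD_le {B : Set ℝ} (hfin : volume B ≠ ⊤) {M : ℝ}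
    (h : ∀ c, volume.real (B ∩ (fun x => c - x) ⁻¹' B) ≤ M) : DD B ≤ M := by
  refine csSup_le ⟨_, ∅, Set.empty_subset _, MeasurableSet.empty, ⟨0, by simp⟩, rfl⟩ ?_
  rintro _ ⟨C, hC, -, ⟨c, hc⟩, rfl⟩
  have hsub : C ⊆ B ∩ (fun x => 2 * c - x) ⁻¹' B := by
    refine fun x hx => ⟨hC hx, hC ?_⟩
    have h1 := hc (x - c)
    rw [show c + (x - c) = x by ring, show c - (x - c) = 2 * c - x by ring] at h1
    exact h1.1 hx
  exact (measureReal_mono hsub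
    (measure_ne_top_of_subset Set.inter_subset_left hfin)).trans (h (2 * c))

theorem DD_nonneg (A : Set ℝ) : 0 ≤ DD A := by
  apply Real.sSup_nonneg
  rintro _ ⟨C, -, -, -, rfl⟩
  exact ENNReal.toReal_nonneg

theorem Δ_nonneg (ε : ℝ) : 0 ≤ Δ ε := by
  apply Real.sInf_nonneg
  rintro _ ⟨A, -, -, -, rfl⟩
  exact DD_nonneg A

theorem Δ_le_DD {ε : ℝ} {A : Set ℝ} (hA1 : A ⊆ Set.Ico 0 1) (hA : MeasurableSet A)
    (hε : volume A = ENNReal.ofReal ε) : Δ ε ≤ DD A := by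
  refine csInf_le ⟨0, ?_⟩ ⟨A, hA1, hA, hε, rfl⟩
  rintro _ ⟨A, -, -, -, rfl⟩
  exact DD_nonneg A

theorem measureReal_inter_preimage_le_DD_add {A A' : Set ℝ} (hA : MeasurableSet A)
    (hA' : MeasurableSet A') (hfin : volume A ≠ ⊤) (hfin' : volume A' ≠ ⊤) (c : ℝ) :
    volume.real (A' ∩ (fun x => c - x) ⁻¹' A') ≤ DD A + 2 * volume.real (A' \ A) := by
  have hd : MeasurableSet (A' \ A) := hA'.diff hA
  have hdfin : volume (A' \ A) ≠ ⊤ := measure_ne_top_of_subset Set.sdiff_subset hfin'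
  have hpfin : volume ((fun x => c - x) ⁻¹' (A' \ A)) ≠ ⊤ := by
    rw [(volume.measurePreserving_sub_left c).measure_preimage hd.nullMeasurableSet]
    exact hdfin
  have hsub : A' ∩ (fun x => c - x) ⁻¹' A' ⊆
      A ∩ (fun x => c - x) ⁻¹' A ∪ (A' \ A) ∪ (fun x => c - x) ⁻¹' (A' \ A) := by
    rintro x ⟨h1, h2⟩
    by_cases h3 : x ∈ A
    · by_cases h4 : c - x ∈ A
      · exact Or.inl (Or.inl ⟨h3, h4⟩)
      · exact Or.inr ⟨h2, h4⟩
    · exact Or.inl (Or.inr ⟨h1, h3⟩)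
  calc volume.real (A' ∩ (fun x => c - x) ⁻¹' A')
      ≤ volume.real (A ∩ (fun x => c - x) ⁻¹' A ∪ (A' \ A) ∪ (fun x => c - x) ⁻¹' (A' \ A)) :=
        measureReal_mono hsub (measure_union_ne_top (measure_union_ne_top
          (measure_ne_top_of_subset Set.inter_subset_left hfin) hdfin) hpfin)
    _ ≤ volume.real (A ∩ (fun x => c - x) ⁻¹' A) + volume.real (A' \ A) +
          volume.real ((fun x => c - x) ⁻¹' (A' \ A)) :=
        (measureReal_union_le _ _).trans (by gcongr; exact measureReal_union_le _ _)
    _ ≤ DD A + 2 * volume.real (A' \ A) := by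
        rw [measureReal_preimage_sub_left c hd]
        linarith [measureReal_inter_preimage_le_DD hA hfin c]

theorem Δ_le_of_approx {A : Set ℝ} (hA : MeasurableSet A) (hA1 : A ⊆ Set.Ico 0 1) {ε δ : ℝ}
    (hε : 0 < ε) (hδ : 0 < δ) (h : ε ≤ volume.real A - δ) :
    Δ ε ≤ (ε / (volume.real A - δ)) ^ 2 * (DD A + 2 * δ) + 2 * δ := by
  obtain ⟨n, hn, hnδ, S, hS, hlow, hdiff⟩ := exists_biUnion_gridCell_approx hA hA1 hδ
  have hA'1 : (⋃ i ∈ S, gridCell n i) ⊆ Set.Ico 0 1 :=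
    Set.iUnion₂_subset fun i hi => gridCell_subset_Ico (hS i hi)
  have hA'm : MeasurableSet (⋃ i ∈ S, gridCell n i) :=
    S.measurableSet_biUnion fun i _ => measurableSet_Ico
  set A' := ⋃ i ∈ S, gridCell n i
  have hfin : ∀ s ⊆ Set.Ico (0 : ℝ) 1, volume s ≠ ⊤ := fun s hs =>
    measure_ne_top_of_subset hs (by simp)
  have hpos : 0 < volume.real A' := by linarith
  obtain ⟨B, hBA, hBm, hB, hBc⟩ := exists_subset_biUnion_gridCell hn hS
    (p := ε / volume.real A') (by positivity) ((div_le_one hpos).2 (by linarith)) hδ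
  change volume.real B = ε / volume.real A' * volume.real A' at hB
  rw [div_mul_cancel₀ _ hpos.ne'] at hB
  have hBfin := hfin B (hBA.trans hA'1)
  refine (Δ_le_DD (hBA.trans hA'1) hBm ?_).trans (DD_le hBfin fun c => (hBc c).trans ?_)
  · rw [← hB, ofReal_measureReal hBfin]
  · have h1 := measureReal_inter_preimage_le_DD_add hA hA'm (hfin A hA1) (hfin A' hA'1) c
    have h2 : volume.real (A' ∩ (fun x => c - x) ⁻¹' A') ≤ DD A + 2 * δ := by linarith
    have h3 : (ε / volume.real A') ^ 2 ≤ (ε / (volume.real A - δ)) ^ 2 := by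
      have : 0 < volume.real A - δ := by linarith
      gcongr
    have h4 := mul_le_mul h3 h2 measureReal_nonneg (sq_nonneg _)
    change (ε / volume.real A') ^ 2 * volume.real (A' ∩ (fun x => c - x) ⁻¹' A') + 1 / n + δ ≤ _
    linarith

theorem Δ_le_sq_mul_DD {A : Set ℝ} (hA : MeasurableSet A) (hA1 : A ⊆ Set.Ico 0 1) {ε : ℝ}
    (hε : 0 < ε) (h : ε < volume.real A) :
    Δ ε ≤ (ε / volume.real A) ^ 2 * DD A := by
  have hcont : ContinuousAt
      (fun δ : ℝ => (ε / (volume.real A - δ)) ^ 2 * (DD A + 2 * δ) + 2 * δ) 0 := by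
    have : volume.real A - 0 ≠ 0 := by linarith
    fun_prop (disch := assumption)
  have hlim := hcont.tendsto.mono_left (nhdsWithin_le_nhds (s := Set.Ioi 0))
  simp only [sub_zero, mul_zero, add_zero] at hlim
  refine ge_of_tendsto hlim ?_
  filter_upwards [Ioo_mem_nhdsGT (sub_pos.2 h)] with δ hδ
  exact Δ_le_of_approx hA hA1 hε hδ.1 (by linarith [hδ.2])

theorem Δ_div_sq_le {ε ε₀ : ℝ} (hε : 0 < ε) (h : ε ≤ ε₀) (h1 : ε₀ ≤ 1) :
    Δ ε / ε ^ 2 ≤ Δ ε₀ / ε₀ ^ 2 := by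
  rcases h.eq_or_lt with rfl | hlt
  · exact le_rfl
  have hε₀ : 0 < ε₀ := hε.trans hlt
  have key : Δ ε / ε ^ 2 * ε₀ ^ 2 ≤ Δ ε₀ := by
    refine le_csInf ⟨_, Set.Ico 0 ε₀, Set.Ico_subset_Ico_right h1, measurableSet_Ico,
      by simp, rfl⟩ ?_
    rintro _ ⟨A, hA1, hA, hv, rfl⟩
    have hvr : volume.real A = ε₀ := by rw [Measure.real, hv, ENNReal.toReal_ofReal hε₀.le]
    have := Δ_le_sq_mul_DD hA hA1 hε (hlt.trans_eq hvr.symm)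
    rw [hvr] at this
    calc Δ ε / ε ^ 2 * ε₀ ^ 2 ≤ (ε / ε₀) ^ 2 * DD A / ε ^ 2 * ε₀ ^ 2 := by gcongr
      _ = DD A := by field_simp
  rwa [le_div_iff₀ (by positivity)]

theorem delta_over_eps_sq_increasing :
    (∀ ε ε₀ : ℝ, 0 < ε → ε ≤ ε₀ → ε₀ ≤ 1 → Δ ε / ε^2 ≤ Δ ε₀ / ε₀^2) ∧
    (∃ L : ℝ, Filter.Tendsto (fun ε => Δ ε / ε^2) (nhdsWithin 0 (Set.Ioi 0)) (nhds L)) := by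
  refine ⟨fun ε ε₀ => Δ_div_sq_le, _,
    MonotoneOn.tendsto_nhdsWithin_Ioo_right (y := 1) ⟨1 / 2, by norm_num, by norm_num⟩
      (fun ε hε ε₀ hε₀ h => Δ_div_sq_le hε.1 h hε₀.2.le) ⟨0, ?_⟩⟩
  rintro _ ⟨ε, -, rfl⟩
  exact div_nonneg (Δ_nonneg ε) (sq_nonneg ε)
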